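/- There is a constant C > 0, depending only on Q, such that for every natural number n: if the word w_n is equal, in the free group on {a,b,r,s,t}, to a product of N conjugates of relators of Q and their inverses, then C·N + 8n + 8 ≥ 2ⁿ. In particular Area(w_n) ≥ (2ⁿ − 8n − 8)/C. -/

import Mathlib

/-! Words over an alphabet `A`: a letter `(x, true)` is the generator `x`,
and `(x, false)` is its formal inverse `x⁻¹`. -/

/-- A word over the alphabet `A ∪ A⁻¹`. -/
abbrev Word (A : Type*) := List (A × Bool)

namespace Word

/-- The formal inverse of a word. -/
def inv {A : Type*} (w : Word A) : Word A := (w.map fun p => (p.1, !p.2)).reverse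

/-- `w'` is a cyclic conjugate (cyclic permutation) of `w`. -/
def IsCyclicConj {A : Type*} (w w' : Word A) : Prop :=
  ∃ u v : Word A, w = u ++ v ∧ w' = v ++ u

end Word

/-- Moves (i)–(iii) on words with respect to a set `R` of relator words:
free reduction, free expansion, and application of a relator (replace a subword `u`
by `v` where some cyclic conjugate of `u * v⁻¹` lies in `R ∪ R⁻¹`). -/
inductive Move {A : Type*} (R : Set (Word A)) : Word A → Word A → Prop
  | freeReduce (u v : Word A) (x : A) (b : Bool) :
      Move R (u ++ (x, b) :: (x, !b) :: v) (u ++ v)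
  | freeExpand (u v : Word A) (x : A) (b : Bool) :
      Move R (u ++ v) (u ++ (x, b) :: (x, !b) :: v)
  | relator (p q u v z : Word A)
      (hz : Word.IsCyclicConj (u ++ Word.inv v) z) (hR : z ∈ R ∨ Word.inv z ∈ R) :
      Move R (p ++ u ++ q) (p ++ v ++ q)

/-- Moves (i)–(iv): moves (i)–(iii) together with cyclic conjugation. -/
inductive MoveC {A : Type*} (R : Set (Word A)) : Word A → Word A → Prop
  | of {w w' : Word A} : Move R w w' → MoveC R w w'
  | cyc {w w' : Word A} : Word.IsCyclicConj w w' → MoveC R w w'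

/-- Moves (i)–(v) on finite sequences of words: one of the moves (i)–(iv) applied to
one word of the sequence, or fragmentation of one word `u ++ v` into `u` and `v`. -/
inductive MoveF {A : Type*} (R : Set (Word A)) : List (Word A) → List (Word A) → Prop
  | of (l₁ l₂ : List (Word A)) {w w' : Word A} :
      MoveC R w w' → MoveF R (l₁ ++ w :: l₂) (l₁ ++ w' :: l₂)
  | frag (l₁ l₂ : List (Word A)) (u v : Word A) :
      MoveF R (l₁ ++ (u ++ v) :: l₂) (l₁ ++ u :: v :: l₂)

/-- A word is null-homotopic over the presentation with relator set `R` if it represents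
the identity of the presented group, i.e. lies in the normal closure of the relators. -/
def NullHomotopic {A : Type*} (R : Set (Word A)) (w : Word A) : Prop :=
  FreeGroup.mk w ∈ Subgroup.normalClosure (FreeGroup.mk '' R)

/-- `FLle R w L`: the word `w` can be converted to the empty word by moves (i)–(iii)
with every intermediate word of length at most `L`. -/
def FLle {A : Type*} (R : Set (Word A)) (w : Word A) (L : ℕ) : Prop :=
  ∃ (m : ℕ) (f : ℕ → Word A), f 0 = w ∧ f m = [] ∧
    (∀ i < m, Move R (f i) (f (i + 1))) ∧ ∀ i ≤ m, (f i).length ≤ L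

/-- `FFLle R w L`: the word `w` can be converted to the empty word by moves (i)–(iv)
with every intermediate word of length at most `L`. -/
def FFLle {A : Type*} (R : Set (Word A)) (w : Word A) (L : ℕ) : Prop :=
  ∃ (m : ℕ) (f : ℕ → Word A), f 0 = w ∧ f m = [] ∧
    (∀ i < m, MoveC R (f i) (f (i + 1))) ∧ ∀ i ≤ m, (f i).length ≤ L

/-- The total length of a finite sequence of words. -/
def totalLength {A : Type*} (l : List (Word A)) : ℕ := (l.map List.length).sum

/-- `FFFLle R w L`: the length-one sequence `(w)` can be converted to a sequence of empty
words by moves (i)–(v) with every intermediate sequence of total length at most `L`. -/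
def FFFLle {A : Type*} (R : Set (Word A)) (w : Word A) (L : ℕ) : Prop :=
  ∃ (m : ℕ) (f : ℕ → List (Word A)), f 0 = [w] ∧ (∀ u ∈ f m, u = ([] : Word A)) ∧
    (∀ i < m, MoveF R (f i) (f (i + 1))) ∧ ∀ i ≤ m, totalLength (f i) ≤ L

/-- An element `x` of the free group is a conjugate of a relator of `R` or of an inverse
of a relator. -/
def IsConjRelator {A : Type*} (R : Set (Word A)) (x : FreeGroup A) : Prop :=
  ∃ c ρ : FreeGroup A, (ρ ∈ FreeGroup.mk '' R ∨ ρ⁻¹ ∈ FreeGroup.mk '' R) ∧ x = c * ρ * c⁻¹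

/-- `AreaLe R g N`: in the free group, `g` is a product of at most `N` conjugates
of elements of `R ∪ R⁻¹`. -/
def AreaLe {A : Type*} (R : Set (Word A)) (g : FreeGroup A) (N : ℕ) : Prop :=
  ∃ l : List (FreeGroup A), l.length ≤ N ∧ (∀ x ∈ l, IsConjRelator R x) ∧ l.prod = g

/-- The number of occurrences in `w` of the letter `x` or its inverse. -/
def countLtr {A : Type*} [DecidableEq A] (x : A) (w : Word A) : ℕ :=
  (w.filter fun p => p.1 = x).length

/-- The filling length `FL(w)` of a null-homotopic word. -/
noncomputable def FLw {A : Type*} (R : Set (Word A)) (w : Word A) : ℕ :=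
  sInf {L | FLle R w L}

/-- The free filling length `FFL(w)` of a null-homotopic word. -/
noncomputable def FFLw {A : Type*} (R : Set (Word A)) (w : Word A) : ℕ :=
  sInf {L | FFLle R w L}

/-- The fragmenting free filling length `FFFL(w)` of a null-homotopic word. -/
noncomputable def FFFLw {A : Type*} (R : Set (Word A)) (w : Word A) : ℕ :=
  sInf {L | FFFLle R w L}

/-- The filling length function `FL : ℕ → ℕ` of the presentation with relators `R`. -/
noncomputable def FLfn {A : Type*} (R : Set (Word A)) (n : ℕ) : ℕ :=
  sSup (FLw R '' {w | NullHomotopic R w ∧ w.length ≤ n})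

/-- The free filling length function `FFL : ℕ → ℕ`. -/
noncomputable def FFLfn {A : Type*} (R : Set (Word A)) (n : ℕ) : ℕ :=
  sSup (FFLw R '' {w | NullHomotopic R w ∧ w.length ≤ n})

/-- The fragmenting free filling length function `FFFL : ℕ → ℕ`. -/
noncomputable def FFFLfn {A : Type*} (R : Set (Word A)) (n : ℕ) : ℕ :=
  sSup (FFFLw R '' {w | NullHomotopic R w ∧ w.length ≤ n})

/-! The presentation `Q = ⟨a, b, r, s, t | a^b a⁻², [t,a], [r,at], [r,s], [s,t]⟩`. -/

/-- The five generators of the presentation `Q`. -/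
inductive QGen | a | b | r | s | t
deriving DecidableEq

/-- The five relators of `Q`: `b⁻¹aba⁻¹a⁻¹`, `t⁻¹a⁻¹ta`, `r⁻¹t⁻¹a⁻¹rat`,
`r⁻¹s⁻¹rs`, `s⁻¹t⁻¹st`. -/
def QRels : Set (Word QGen) :=
  { [(QGen.b, false), (QGen.a, true), (QGen.b, true), (QGen.a, false), (QGen.a, false)],
    [(QGen.t, false), (QGen.a, false), (QGen.t, true), (QGen.a, true)],
    [(QGen.r, false), (QGen.t, false), (QGen.a, false), (QGen.r, true), (QGen.a, true),
      (QGen.t, true)],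
    [(QGen.r, false), (QGen.s, false), (QGen.r, true), (QGen.s, true)],
    [(QGen.s, false), (QGen.t, false), (QGen.s, true), (QGen.t, true)] }

/-- The word `bⁿ`. -/
def bpow (n : ℕ) : Word QGen := List.replicate n (QGen.b, true)

/-- The word `b⁻ⁿ`. -/
def bpowInv (n : ℕ) : Word QGen := List.replicate n (QGen.b, false)

/-- The word `a^{-bⁿ} = b⁻ⁿ a⁻¹ bⁿ`. -/
def aConjNeg (n : ℕ) : Word QGen := bpowInv n ++ [(QGen.a, false)] ++ bpow n

/-- The word `a^{bⁿ} = b⁻ⁿ a bⁿ`. -/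
def aConjPos (n : ℕ) : Word QGen := bpowInv n ++ [(QGen.a, true)] ++ bpow n

/-- The word `a^{-bⁿ} r a^{bⁿ}`. -/
def gword (n : ℕ) : Word QGen := aConjNeg n ++ [(QGen.r, true)] ++ aConjPos n

/-- The word `w_n = [s, a^{-bⁿ} r a^{bⁿ}] = s⁻¹ (b⁻ⁿa⁻¹bⁿ r b⁻ⁿabⁿ)⁻¹ s (b⁻ⁿa⁻¹bⁿ r b⁻ⁿabⁿ)`. -/
def wn (n : ℕ) : Word QGen :=
  [(QGen.s, false)] ++ Word.inv (gword n) ++ [(QGen.s, true)] ++ gword n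

/-- The word `a^{-bⁿ} r a^{bⁿ} r a^{bⁿ} r⁻¹ a^{-bⁿ}`. -/
def g'word (n : ℕ) : Word QGen :=
  aConjNeg n ++ [(QGen.r, true)] ++ aConjPos n ++ [(QGen.r, true)] ++ aConjPos n ++
    [(QGen.r, false)] ++ aConjNeg n

/-- The word `w'_n = [s, a^{-bⁿ} r a^{bⁿ} r a^{bⁿ} r⁻¹ a^{-bⁿ}]`. -/
def w'n (n : ℕ) : Word QGen :=
  [(QGen.s, false)] ++ Word.inv (g'word n) ++ [(QGen.s, true)] ++ g'word n

namespace AreaLowerBound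

/-- The points on which the generators of `Q` act: a rational position on one of two lines, together
with a rational counter. -/
abbrev Pt := ℚ × Bool × ℚ

/-- A potential on the two lines, whose two branches agree exactly at position `-m`. -/
def height (m x : ℚ) (i : Bool) : ℚ := if i then 2 * m + x else -x

/-- Translation of both lines by `1`. -/
def translate : Equiv.Perm Pt where
  toFun y := (y.1 + 1, y.2)
  invFun y := (y.1 - 1, y.2)
  left_inv y := by simp
  right_inv y := by simp

/-- Halving of the position. -/
def halve : Equiv.Perm Pt where
  toFun y := (y.1 / 2, y.2)
  invFun y := (y.1 * 2, y.2)
  left_inv y := by simp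
  right_inv y := by simp

/-- Exchange of the two lines at position `-m`. -/
def swapAt (m : ℚ) : Equiv.Perm Pt where
  toFun y := (y.1, if y.1 = -m then !y.2.1 else y.2.1, y.2.2)
  invFun y := (y.1, if y.1 = -m then !y.2.1 else y.2.1, y.2.2)
  left_inv y := by by_cases h : y.1 = -m <;> simp [h, Prod.ext_iff]
  right_inv y := by by_cases h : y.1 = -m <;> simp [h, Prod.ext_iff]

/-- Addition of the potential to the counter. -/
def addHeight (m : ℚ) : Equiv.Perm Pt where
  toFun y := (y.1, y.2.1, y.2.2 + height m y.1 y.2.1)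
  invFun y := (y.1, y.2.1, y.2.2 - height m y.1 y.2.1)
  left_inv y := by simp
  right_inv y := by simp

/-- The action of the generators of `Q`. The relators other than `[s, t]` act trivially. -/
def gen (m : ℚ) : QGen → Equiv.Perm Pt
  | .a => translate⁻¹
  | .b => halve
  | .r => swapAt m
  | .s => addHeight m
  | .t => translate

@[simp] lemma translate_apply (x i q) : translate (x, i, q) = (x + 1, i, q) := rfl
@[simp] lemma translate_symm_apply (x i q) : translate.symm (x, i, q) = (x - 1, i, q) := rfl
@[simp] lemma halve_apply (x i q) : halve (x, i, q) = (x / 2, i, q) := rfl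
@[simp] lemma halve_symm_apply (x i q) : halve.symm (x, i, q) = (x * 2, i, q) := rfl
@[simp] lemma swapAt_apply (m x i q) :
    swapAt m (x, i, q) = (x, if x = -m then !i else i, q) := rfl
@[simp] lemma swapAt_symm_apply (m x i q) :
    (swapAt m).symm (x, i, q) = (x, if x = -m then !i else i, q) := rfl
@[simp] lemma addHeight_apply (m x i q) :
    addHeight m (x, i, q) = (x, i, q + height m x i) := rfl
@[simp] lemma addHeight_symm_apply (m x i q) :
    (addHeight m).symm (x, i, q) = (x, i, q - height m x i) := rfl

/-- Translation of the counter by `d`. -/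
def addCounter (d : ℚ) (y : Pt) : Pt := (y.1, y.2.1, y.2.2 + d)

lemma lift_addCounter (m d : ℚ) (c : FreeGroup QGen) (y : Pt) :
    FreeGroup.lift (gen m) c (addCounter d y) = addCounter d (FreeGroup.lift (gen m) c y) := by
  induction c using FreeGroup.induction_on generalizing y with
  | C1 => simp
  | of g =>
    obtain ⟨x, i, q⟩ := y
    cases g <;> simp [gen, addCounter]
    ring
  | inv_of g ih =>
    rw [map_inv, Equiv.Perm.inv_eq_iff_eq, ih]
    simp
  | mul c₁ c₂ h₁ h₂ => simp [h₁, h₂]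

/-- `σ` fixes positions and changes the counter by at most `k` at every point. -/
def MovesCounterBy (k : ℚ) (σ : Equiv.Perm Pt) : Prop :=
  ∀ y, ∃ d, |d| ≤ k ∧ σ y = addCounter d y

lemma MovesCounterBy.inv {k : ℚ} {σ : Equiv.Perm Pt} (h : MovesCounterBy k σ) :
    MovesCounterBy k σ⁻¹ := by
  intro y
  obtain ⟨d, hd, e⟩ := h (σ⁻¹ y)
  refine ⟨-d, by rwa [abs_neg], ?_⟩
  have e : y = addCounter d (σ⁻¹ y) := by simpa using e
  generalize σ⁻¹ y = z at e
  subst e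
  simp [addCounter]

lemma MovesCounterBy.mul {k l : ℚ} {σ τ : Equiv.Perm Pt} (h : MovesCounterBy k σ)
    (h' : MovesCounterBy l τ) : MovesCounterBy (k + l) (σ * τ) := by
  intro y
  obtain ⟨d, hd, e⟩ := h' y
  obtain ⟨d', hd', e'⟩ := h (τ y)
  refine ⟨d' + d, (abs_add_le _ _).trans (add_le_add hd' hd), ?_⟩
  rw [Equiv.Perm.mul_apply, e', e]
  simp [addCounter, add_assoc, add_comm d]

lemma movesCounterBy_of_mem (m : ℚ) {ρ : FreeGroup QGen} (h : ρ ∈ FreeGroup.mk '' QRels) :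
    MovesCounterBy 1 (FreeGroup.lift (gen m) ρ) := by
  obtain ⟨w, hw, rfl⟩ := h
  rintro ⟨x, i, q⟩
  simp only [QRels, Set.mem_insert_iff, Set.mem_singleton_iff] at hw
  rcases hw with rfl | rfl | rfl | rfl | rfl
  · refine ⟨0, by simp, ?_⟩
    simp [FreeGroup.lift_mk, gen, addCounter]
    ring
  · refine ⟨0, by simp, ?_⟩
    simp [FreeGroup.lift_mk, gen, addCounter]
  · refine ⟨0, by simp, ?_⟩
    by_cases h : x = -m <;> simp [FreeGroup.lift_mk, gen, addCounter, h]
  · refine ⟨0, by simp, ?_⟩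
    by_cases h : x = -m <;> simp [FreeGroup.lift_mk, gen, addCounter, h]
    cases i <;> simp [height] <;> ring
  · refine ⟨height m (x + 1) i - height m x i, ?_, ?_⟩
    · cases i <;> simp [height]
    · simp [FreeGroup.lift_mk, gen, addCounter]
      ring

lemma movesCounterBy_of_isConjRelator (m : ℚ) {x : FreeGroup QGen}
    (h : IsConjRelator QRels x) : MovesCounterBy 1 (FreeGroup.lift (gen m) x) := by
  obtain ⟨c, ρ, hρ, rfl⟩ := h
  have hρ' : MovesCounterBy 1 (FreeGroup.lift (gen m) ρ) := by
    rcases hρ with hρ | hρ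
    · exact movesCounterBy_of_mem m hρ
    · simpa using (movesCounterBy_of_mem m hρ).inv
  intro y
  obtain ⟨d, hd, e⟩ := hρ' (FreeGroup.lift (gen m) c⁻¹ y)
  refine ⟨d, hd, ?_⟩
  rw [map_mul, map_mul, Equiv.Perm.mul_apply, Equiv.Perm.mul_apply, e, lift_addCounter]
  simp

lemma movesCounterBy_prod (m : ℚ) (l : List (FreeGroup QGen))
    (h : ∀ x ∈ l, IsConjRelator QRels x) :
    MovesCounterBy l.length (FreeGroup.lift (gen m) l.prod) := by
  induction l with
  | nil => exact fun y => ⟨0, by simp, by simp [addCounter]⟩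
  | cons x l ih =>
    have := (movesCounterBy_of_isConjRelator m (h x (by simp))).mul
      (ih fun z hz => h z (by simp [hz]))
    simpa [add_comm] using this

lemma halve_pow_apply (n : ℕ) (x i q) : (halve ^ n) (x, i, q) = (x / 2 ^ n, i, q) := by
  induction n generalizing x with
  | zero => simp
  | succ n ih => simp [pow_succ, ih, div_div, mul_comm]

lemma halve_pow_symm_apply (n : ℕ) (x i q) :
    (halve ^ n).symm (x, i, q) = (x * 2 ^ n, i, q) := by
  rw [Equiv.symm_apply_eq, halve_pow_apply]
  simp

lemma lift_aConjPos (m : ℚ) (n : ℕ) (x i q) :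
    FreeGroup.lift (gen m) (.mk (aConjPos n)) (x, i, q) = (x - 2 ^ n, i, q) := by
  simp [aConjPos, bpow, bpowInv, FreeGroup.lift_mk, gen, halve_pow_apply, halve_pow_symm_apply,
    sub_mul]

lemma lift_aConjNeg (m : ℚ) (n : ℕ) (x i q) :
    FreeGroup.lift (gen m) (.mk (aConjNeg n)) (x, i, q) = (x + 2 ^ n, i, q) := by
  simp [aConjNeg, bpow, bpowInv, FreeGroup.lift_mk, gen, halve_pow_apply, halve_pow_symm_apply,
    add_mul]

lemma lift_gword (n : ℕ) (q : ℚ) :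
    FreeGroup.lift (gen (2 ^ n)) (.mk (gword n)) (0, false, q) = (0, true, q) := by
  rw [gword, ← FreeGroup.mul_mk, ← FreeGroup.mul_mk, map_mul, map_mul, Equiv.Perm.mul_apply,
    Equiv.Perm.mul_apply, lift_aConjPos]
  have hr : FreeGroup.lift (gen (2 ^ n)) (.mk [(QGen.r, true)]) (0 - 2 ^ n, false, q) =
      (0 - 2 ^ n, true, q) := by
    simp [FreeGroup.lift_mk, gen]
  rw [hr, lift_aConjNeg, sub_add_cancel]

lemma lift_wn (n : ℕ) :
    FreeGroup.lift (gen (2 ^ n)) (.mk (wn n)) (0, false, 0) = (0, false, 2 * 2 ^ n) := by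
  have hinv : FreeGroup.mk (Word.inv (gword n)) = (FreeGroup.mk (gword n))⁻¹ := rfl
  have key : (FreeGroup.lift (gen (2 ^ n)) (.mk (gword n)))⁻¹ (0, true, 2 * 2 ^ n) =
      (0, false, 2 * 2 ^ n) := by
    rw [Equiv.Perm.inv_eq_iff_eq, lift_gword]
  rw [wn, ← FreeGroup.mul_mk, ← FreeGroup.mul_mk, ← FreeGroup.mul_mk, hinv, map_mul, map_mul,
    map_mul, map_inv, Equiv.Perm.mul_apply, Equiv.Perm.mul_apply, Equiv.Perm.mul_apply,
    lift_gword]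
  have hs : FreeGroup.lift (gen (2 ^ n)) (.mk [(QGen.s, true)]) (0, true, 0) =
      (0, true, 2 * 2 ^ n) := by
    simp [FreeGroup.lift_mk, gen, height]
  rw [hs, key]
  simp [FreeGroup.lift_mk, gen, height]

end AreaLowerBound

theorem area_wn_lower_bound :
    ∃ C : ℕ, 0 < C ∧ ∀ (n N : ℕ) (l : List (FreeGroup QGen)),
      l.length = N → (∀ x ∈ l, IsConjRelator QRels x) →
      l.prod = FreeGroup.mk (wn n) →
      2 ^ n ≤ C * N + 8 * n + 8 := by
  refine ⟨1, one_pos, fun n N l hN hl hprod => ?_⟩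
  obtain ⟨d, hd, e⟩ := AreaLowerBound.movesCounterBy_prod (2 ^ n) l hl (0, false, 0)
  rw [hprod, AreaLowerBound.lift_wn, AreaLowerBound.addCounter] at e
  simp only [Prod.mk.injEq, true_and, zero_add] at e
  rw [← e, hN, abs_of_nonneg (by positivity)] at hd
  have : 2 * 2 ^ n ≤ N := by exact_mod_cast hd
  omega
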